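/- The only analytic C₀-group of composition operators on H²(𝔻) or on the Dirichlet space 𝒟 is the trivial group (T(t) = I for all t). -/

import Mathlib

open Complex MeasureTheory Filter Set Metric
open scoped Real Topology ENNReal

noncomputable section

/-- The weighted Hardy space `H²(β)`, modeled as the `ℓ²` space of weighted
Taylor coefficient sequences: the function `f(z) = Σ cₙ zⁿ` corresponds to the
square-summable sequence `(cₙ βₙ)ₙ`. -/
abbrev WH2 : Type := lp (fun _ : ℕ => ℂ) 2

/-- The analytic function on the unit disc associated to an element of `H²(β)`. -/
def wToFun (β : ℕ → ℝ) (f : WH2) (z : ℂ) : ℂ := ∑' n : ℕ, (f n / (β n : ℂ)) * z ^ n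

/-- The open unit disc. -/
def uDisc : Set ℂ := Metric.ball 0 1

/-- Weights of the classical Hardy space `H²(𝔻)` (`βₙ = 1`). -/
def hardyW : ℕ → ℝ := fun _ => 1

/-- Weights of the Dirichlet space `𝒟` (`β₀ = 1`, `βₙ = √n`). -/
def dirichletW : ℕ → ℝ := fun n => if n = 0 then 1 else Real.sqrt n

/-- The monomial `eₙ(z) = zⁿ` as an element of `H²(β)`. -/
def eW (β : ℕ → ℝ) (n : ℕ) : WH2 := lp.single 2 n ((β n : ℝ) : ℂ)

/-- `T` acts as the composition operator with analytic self-map symbol `φ` on `H²(β)`. -/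
def RepresentsComp (β : ℕ → ℝ) (T : WH2 →L[ℂ] WH2) (φ : ℂ → ℂ) : Prop :=
  DifferentiableOn ℂ φ uDisc ∧ MapsTo φ uDisc uDisc ∧
  ∀ f : WH2, ∀ z ∈ uDisc, wToFun β (T f) z = wToFun β f (φ z)

/-- `T` is a composition operator on `H²(β)`. -/
def IsCompositionOperator (β : ℕ → ℝ) (T : WH2 →L[ℂ] WH2) : Prop :=
  ∃ φ : ℂ → ℂ, RepresentsComp β T φ

/-- `T` is a weighted composition operator `f ↦ w · (f ∘ φ)` on `H²(𝔻)`. -/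
def IsWeightedCompOp (T : WH2 →L[ℂ] WH2) : Prop :=
  ∃ w φ : ℂ → ℂ, DifferentiableOn ℂ w uDisc ∧ DifferentiableOn ℂ φ uDisc ∧
    MapsTo φ uDisc uDisc ∧
    ∀ f : WH2, ∀ z ∈ uDisc, wToFun hardyW (T f) z = w z * wToFun hardyW f (φ z)

section Semigroup

variable {X : Type*} [NormedAddCommGroup X] [NormedSpace ℂ X]

/-- `T` is a `C₀`-semigroup (indexed by `t ≥ 0`). -/
def IsC0Semigroup (T : ℝ → X →L[ℂ] X) : Prop :=
  T 0 = 1 ∧ (∀ s t : ℝ, 0 ≤ s → 0 ≤ t → T (s + t) = (T s).comp (T t)) ∧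
  ∀ x : X, Tendsto (fun t : ℝ => T t x) (𝓝[≥] 0) (𝓝 x)

/-- `T` is a `C₀`-group (indexed by `t ∈ ℝ`). -/
def IsC0Group (T : ℝ → X →L[ℂ] X) : Prop :=
  T 0 = 1 ∧ (∀ s t : ℝ, T (s + t) = (T s).comp (T t)) ∧
  ∀ x : X, Tendsto (fun t : ℝ => T t x) (𝓝 0) (𝓝 x)

/-- Quasicontractive: `‖T(t)‖ ≤ e^{wt}` for some `w ≥ 0` and all `t ≥ 0`. -/
def Quasicontractive (T : ℝ → X →L[ℂ] X) : Prop :=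
  ∃ w : ℝ, 0 ≤ w ∧ ∀ t : ℝ, 0 ≤ t → ‖T t‖ ≤ Real.exp (w * t)

/-- The sector `Σ_θ = {re^{iα} : r ≥ 0, |α| < θ}` (note `arg 0 = 0`). -/
def Sector (θ : ℝ) : Set ℂ := {z : ℂ | |Complex.arg z| < θ}

/-- `Te` is an analytic extension of the semigroup `T` to the sector `Σ_θ`,
bounded on `Σ_θ ∩ 𝔻`. -/
def IsAnalyticExtension (T : ℝ → X →L[ℂ] X) (θ : ℝ) (Te : ℂ → X →L[ℂ] X) : Prop :=
  (∀ t : ℝ, 0 ≤ t → Te t = T t) ∧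
  DifferentiableOn ℂ Te (Sector θ \ {0}) ∧
  ∃ M : ℝ, ∀ ξ ∈ Sector θ, ‖ξ‖ < 1 → ‖Te ξ‖ ≤ M

/-- The semigroup `T` extends analytically and boundedly to the sector `Σ_θ`. -/
def HasAnalyticExtension (T : ℝ → X →L[ℂ] X) (θ : ℝ) : Prop :=
  ∃ Te : ℂ → X →L[ℂ] X, IsAnalyticExtension T θ Te

/-- The semigroup `T` is analytic (on some sector `Σ_θ`, `θ ∈ (0, π/2]`). -/
def IsAnalyticSemigroup (T : ℝ → X →L[ℂ] X) : Prop :=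
  ∃ θ ∈ Set.Ioc 0 (π / 2), HasAnalyticExtension T θ

/-- `y` is the limit of `(T(t)x - x)/t` as `t → 0⁺`. -/
def GenLimit (T : ℝ → X →L[ℂ] X) (x y : X) : Prop :=
  Tendsto (fun t : ℝ => (t : ℂ)⁻¹ • (T t x - x)) (𝓝[>] 0) (𝓝 y)

/-- `A`, with domain `D`, is the infinitesimal generator of the semigroup `T`. -/
def IsGenerator (T : ℝ → X →L[ℂ] X) (D : Set X) (A : X → X) : Prop :=
  (∀ x ∈ D, GenLimit T x (A x)) ∧ ∀ x : X, (∃ y, GenLimit T x y) → x ∈ D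

/-- `y` is the two-sided limit of `(T(t)x - x)/t` as `t → 0` (for groups). -/
def GenLimitGrp (T : ℝ → X →L[ℂ] X) (x y : X) : Prop :=
  Tendsto (fun t : ℝ => (t : ℂ)⁻¹ • (T t x - x)) (𝓝[≠] 0) (𝓝 y)

/-- `A`, with domain `D`, is the infinitesimal generator of the group `T`. -/
def IsGeneratorGrp (T : ℝ → X →L[ℂ] X) (D : Set X) (A : X → X) : Prop :=
  (∀ x ∈ D, GenLimitGrp T x (A x)) ∧ ∀ x : X, (∃ y, GenLimitGrp T x y) → x ∈ D

/-- Immediately compact semigroup: `T(t)` is compact for all `t > 0`. -/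
def ImmediatelyCompact (T : ℝ → X →L[ℂ] X) : Prop :=
  ∀ t : ℝ, 0 < t → IsCompactOperator (T t)

/-- Eventually compact semigroup: `T(t)` is compact for all `t ≥ t₀`, some `t₀ > 0`. -/
def EventuallyCompact (T : ℝ → X →L[ℂ] X) : Prop :=
  ∃ t₀ : ℝ, 0 < t₀ ∧ ∀ t : ℝ, t₀ ≤ t → IsCompactOperator (T t)

end Semigroup

/-- The natural domain of the operator `A f = G f'` in `H²(β)`: those `f` for which
`G · (wToFun β f)'` is realized by some element of `H²(β)`. -/
def domA (β : ℕ → ℝ) (G : ℂ → ℂ) : Set WH2 :=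
  {f : WH2 | ∃ g : WH2, ∀ z ∈ uDisc, wToFun β g z = G z * deriv (wToFun β f) z}

open Classical in
/-- The operator `A f = G f'` on `H²(β)` (defined via choice on its natural domain). -/
def opA (β : ℕ → ℝ) (G : ℂ → ℂ) (f : WH2) : WH2 :=
  if h : f ∈ domA β G then h.choose else 0

/-- `(φ_t)_{t ≥ 0}` is a (jointly continuous) semiflow of analytic self-maps of `𝔻`. -/
def IsSemiflow (φ : ℝ → ℂ → ℂ) : Prop :=
  (∀ z ∈ uDisc, φ 0 z = z) ∧
  (∀ t : ℝ, 0 ≤ t → DifferentiableOn ℂ (φ t) uDisc ∧ MapsTo (φ t) uDisc uDisc) ∧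
  (∀ s t : ℝ, 0 ≤ s → 0 ≤ t → ∀ z ∈ uDisc, φ (s + t) z = φ s (φ t z)) ∧
  ContinuousOn (fun p : ℝ × ℂ => φ p.1 p.2) (Set.Ici 0 ×ˢ uDisc)

/-- `G` is the infinitesimal generator of the semiflow `φ`: `∂φ_t/∂t = G ∘ φ_t`. -/
def SemiflowGenerator (φ : ℝ → ℂ → ℂ) (G : ℂ → ℂ) : Prop :=
  ∀ z ∈ uDisc, ∀ t : ℝ, 0 ≤ t → HasDerivAt (fun s : ℝ => φ s z) (G (φ t z)) t

/-- Hilbert–Schmidt operator on `WH2` (w.r.t. the standard orthonormal basis). -/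
def IsHilbertSchmidt (T : WH2 →L[ℂ] WH2) : Prop :=
  Summable (fun n : ℕ => ‖T (lp.single 2 n (1 : ℂ))‖ ^ 2)

/-- Trace-class operator on `WH2`: a product of two Hilbert–Schmidt operators. -/
def IsTraceClass (T : WH2 →L[ℂ] WH2) : Prop :=
  ∃ A B : WH2 →L[ℂ] WH2, IsHilbertSchmidt A ∧ IsHilbertSchmidt B ∧ T = A.comp B

/-- `‖φ‖_∞ < 1` for a function on the unit disc. -/
def SupNormLtOne (φ : ℂ → ℂ) : Prop :=
  ∃ r : ℝ, r < 1 ∧ ∀ z ∈ uDisc, ‖φ z‖ ≤ r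

/-- Essential boundary condition via radial limits: for almost every boundary point
`ξ = e^{it}`, whenever the radial limit `L` of `G` at `ξ` exists,
`Re (e^{iα} ξ̄ L) ≤ c`.  (This encodes `ess sup_(z ∈ 𝕋) Re (e^{iα} z̄ G(z)) ≤ c`.) -/
def BoundaryReLe (G : ℂ → ℂ) (α : ℝ) (c : ℝ) : Prop :=
  ∀ᵐ t : ℝ, ∀ L : ℂ,
    Tendsto (fun r : ℝ => G ((r : ℂ) * Complex.exp ((t : ℂ) * Complex.I)))
      (𝓝[<] 1) (𝓝 L) →
    (Complex.exp ((α : ℂ) * Complex.I) *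
      (starRingEnd ℂ) (Complex.exp ((t : ℂ) * Complex.I)) * L).re ≤ c

/-- `Re (z̄ G(z)) = 0` almost everywhere on the unit circle, via radial limits. -/
def BoundaryReEqZero (G : ℂ → ℂ) : Prop :=
  ∀ᵐ t : ℝ, ∀ L : ℂ,
    Tendsto (fun r : ℝ => G ((r : ℂ) * Complex.exp ((t : ℂ) * Complex.I)))
      (𝓝[<] 1) (𝓝 L) →
    ((starRingEnd ℂ) (Complex.exp ((t : ℂ) * Complex.I)) * L).re = 0

end

lemma norm_coeff_div_le {β : ℕ → ℝ} (hβ : ∀ n, 1 ≤ β n) (f : WH2) (n : ℕ) :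
    ‖f n / (β n : ℂ)‖ ≤ ‖f‖ := by
  rw [norm_div, norm_real, Real.norm_of_nonneg (zero_le_one.trans (hβ n))]
  exact (div_le_self (norm_nonneg _) (hβ n)).trans (lp.norm_apply_le_norm (by norm_num) f n)

/-- A power series on the unit disc with bounded coefficients and zero sum is trivial. -/
lemma coeff_eq_zero_of_hasSum_zero {a : ℕ → ℂ} {K : ℝ} (ha : ∀ n, ‖a n‖ ≤ K)
    (h : ∀ z ∈ uDisc, HasSum (fun n => a n * z ^ n) 0) : a = 0 := by
  have hp : HasFPowerSeriesOnBall (fun _ : ℂ => (0 : ℂ))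
      (FormalMultilinearSeries.ofScalars ℂ a) 0 1 := by
    refine ⟨?_, one_pos, ?_⟩
    · have := (FormalMultilinearSeries.ofScalars ℂ a).le_radius_of_bound K (r := 1) (by
        intro n
        simpa using (FormalMultilinearSeries.ofScalars_norm_eq_mul (E := ℂ) a n).le.trans
          (by simpa using ha n))
      simpa using this
    · intro y hy
      have hy' : y ∈ uDisc := by
        simpa [uDisc, Metric.mem_eball, edist_zero_right, ← ofReal_norm] using hy
      simpa [FormalMultilinearSeries.ofScalars_apply_eq, mul_comm] using h y hy'
  have h0 := hp.hasFPowerSeriesAt.eq_zero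
  funext n
  rw [← FormalMultilinearSeries.coeff_ofScalars (𝕜 := ℂ) (p := a) (n := n), h0]
  rfl

lemma summable_wToFun {β : ℕ → ℝ} (hβ : ∀ n, 1 ≤ β n) (f : WH2) {z : ℂ} (hz : z ∈ uDisc) :
    Summable (fun n => (f n / (β n : ℂ)) * z ^ n) := by
  have hz' : ‖z‖ < 1 := by simpa [uDisc] using hz
  refine Summable.of_norm_bounded
    ((summable_geometric_of_lt_one (norm_nonneg z) hz').mul_left ‖f‖) fun n => ?_
  rw [norm_mul, norm_pow]
  gcongr
  exact norm_coeff_div_le hβ f n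

/-- Evaluation at a point of the disc as a continuous linear functional. -/
noncomputable def evalCLM {β : ℕ → ℝ} (hβ : ∀ n, 1 ≤ β n) {z : ℂ} (hz : z ∈ uDisc) : WH2 →L[ℂ] ℂ :=
  LinearMap.mkContinuous
    { toFun := fun f => wToFun β f z
      map_add' := fun f g => by
        simp only [wToFun, lp.coeFn_add, Pi.add_apply, add_div, add_mul]
        exact (summable_wToFun hβ f hz).tsum_add (summable_wToFun hβ g hz)
      map_smul' := fun c f => by
        simp only [wToFun, lp.coeFn_smul, Pi.smul_apply, smul_eq_mul, RingHom.id_apply,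
          ← tsum_mul_left, mul_div_assoc, mul_assoc] }
    (1 - ‖z‖)⁻¹ fun f => by
      have hz' : ‖z‖ < 1 := by simpa [uDisc] using hz
      have hs := (hasSum_geometric_of_lt_one (norm_nonneg z) hz').mul_right ‖f‖
      refine tsum_of_norm_bounded hs fun n => ?_
      rw [norm_mul, norm_pow, mul_comm]
      gcongr
      exact norm_coeff_div_le hβ f n

@[simp]
lemma evalCLM_apply {β : ℕ → ℝ} (hβ : ∀ n, 1 ≤ β n) {z : ℂ} (hz : z ∈ uDisc) (f : WH2) :
    evalCLM hβ hz f = wToFun β f z := rfl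

lemma wToFun_eW {β : ℕ → ℝ} (hβ : ∀ n, 1 ≤ β n) (n : ℕ) (z : ℂ) :
    wToFun β (eW β n) z = z ^ n := by
  have h0 : (β n : ℂ) ≠ 0 := by exact_mod_cast (zero_lt_one.trans_le (hβ n)).ne'
  rw [wToFun, tsum_eq_single n]
  · simp [eW, h0]
  · intro m hm
    simp [eW, hm]

lemma norm_eW {β : ℕ → ℝ} (hβ : ∀ n, 1 ≤ β n) (n : ℕ) : ‖eW β n‖ = β n := by
  rw [eW, lp.norm_single (by norm_num), norm_real, Real.norm_eq_abs,
    abs_of_nonneg (zero_le_one.trans (hβ n))]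

/-- A continuous operator on `H²(β)` vanishing on all monomials is zero. -/
lemma eq_zero_of_forall_eW {β : ℕ → ℝ} (hβ : ∀ n, 1 ≤ β n) {A : WH2 →L[ℂ] WH2}
    (h : ∀ n, A (eW β n) = 0) : A = 0 := by
  ext1 f
  have hs := (lp.hasSum_single (p := 2) (by norm_num) f).mapL A
  have hz : ∀ n, A (lp.single 2 n (f n)) = 0 := fun n => by
    have h0 : (β n : ℂ) ≠ 0 := by exact_mod_cast (zero_lt_one.trans_le (hβ n)).ne'
    have : lp.single 2 n (f n) = (f n / (β n : ℂ)) • eW β n := by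
      rw [eW, ← lp.single_smul, smul_eq_mul, div_mul_cancel₀ _ h0]
    rw [this, map_smul, h, smul_zero]
  simp only [hz] at hs
  simpa using hs.unique hasSum_zero

/-- If a bounded operator acts on monomials as `f ↦ G f'` with `G = A e₁`, on a space whose
weights satisfy `βₙ ≤ 2 βₖ₊ₙ₋₁`, then it is zero. -/
lemma eq_zero_of_derivation {β : ℕ → ℝ} (hβ : ∀ n, 1 ≤ β n)
    (hgrow : ∀ k n, 1 ≤ n → β (n + 1) ≤ 2 * β (k + n)) {A : WH2 →L[ℂ] WH2}
    (hA : ∀ n, ∀ z ∈ uDisc,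
      wToFun β (A (eW β n)) z = n * z ^ (n - 1) * wToFun β (A (eW β 1)) z) : A = 0 := by
  have hb0 : ∀ n, (β n : ℂ) ≠ 0 := fun n => by
    exact_mod_cast (zero_lt_one.trans_le (hβ n)).ne'
  have coeff_eq : ∀ n k, A (eW β (n + 1)) (k + n) / (β (k + n) : ℂ) =
      (n + 1 : ℂ) * (A (eW β 1) k / (β k : ℂ)) := by
    intro n
    set b : ℕ → ℂ := fun m => if m < n then 0 else
      (n + 1 : ℂ) * (A (eW β 1) (m - n) / (β (m - n) : ℂ)) with hb
    have key := coeff_eq_zero_of_hasSum_zero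
      (a := fun m => A (eW β (n + 1)) m / (β m : ℂ) - b m)
      (K := ‖A (eW β (n + 1))‖ + (n + 1) * ‖A (eW β 1)‖) ?_ ?_
    · intro k
      have := congrFun key (k + n)
      simpa [hb, sub_eq_zero] using this
    · intro m
      refine (norm_sub_le _ _).trans <| add_le_add (norm_coeff_div_le hβ _ _) ?_
      by_cases hm : m < n
      · simp only [hb, hm, if_true, norm_zero]
        positivity
      · simp only [hb, hm, if_false, norm_mul]
        refine mul_le_mul (by exact_mod_cast (norm_natCast (n + 1)).le)
          (norm_coeff_div_le hβ _ _) (norm_nonneg _) (by positivity)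
    · intro z hz
      have h1 := (summable_wToFun hβ (A (eW β (n + 1))) hz).hasSum
      have h2 := ((summable_wToFun hβ (A (eW β 1)) hz).hasSum).mul_left ((n + 1 : ℂ) * z ^ n)
      have h3 : HasSum (fun m => b m * z ^ m)
          ((n + 1 : ℂ) * z ^ n * wToFun β (A (eW β 1)) z) := by
        rw [← hasSum_nat_add_iff' n, Finset.sum_eq_zero, sub_zero]
        · refine h2.congr_fun fun k => ?_
          simp [hb, pow_add]
          ring
        · intro i hi
          simp [hb, Finset.mem_range.1 hi]
      have h4 := h1.sub h3
      have h5 := hA (n + 1) z hz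
      simp only [Nat.add_sub_cancel, Nat.cast_add, Nat.cast_one] at h5
      have h6 : (∑' m, A (eW β (n + 1)) m / (β m : ℂ) * z ^ m) =
        (n + 1 : ℂ) * z ^ n * wToFun β (A (eW β 1)) z := h5
      rw [h6, sub_self] at h4
      simpa [sub_mul] using h4
  have hG : A (eW β 1) = 0 := by
    ext k
    set g := A (eW β 1) k / (β k : ℂ) with hg
    have bound : ∀ n : ℕ, (n : ℝ) * ‖g‖ ≤ 2 * ‖A‖ := by
      intro n
      rcases Nat.eq_zero_or_pos n with rfl | hn
      · simp
      have hpos : 0 < β (k + n) := zero_lt_one.trans_le (hβ _)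
      have e1 : A (eW β (n + 1)) (k + n) = (n + 1 : ℂ) * g * (β (k + n) : ℂ) := by
        rw [← coeff_eq n k, div_mul_cancel₀ _ (hb0 _)]
      have e2 : ‖A (eW β (n + 1)) (k + n)‖ ≤ ‖A‖ * β (n + 1) :=
        (lp.norm_apply_le_norm (by norm_num) _ _).trans
          ((A.le_opNorm _).trans_eq (by rw [norm_eW hβ]))
      have e3 : ‖A (eW β (n + 1)) (k + n)‖ = (n + 1) * ‖g‖ * β (k + n) := by
        rw [e1, norm_mul, norm_mul, norm_real, Real.norm_of_nonneg hpos.le]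
        rw [← Nat.cast_add_one, Complex.norm_natCast, Nat.cast_add_one]
      have e4 : (n + 1) * ‖g‖ * β (k + n) ≤ 2 * ‖A‖ * β (k + n) := by
        rw [← e3]
        refine e2.trans ?_
        have := mul_le_mul_of_nonneg_left (hgrow k n hn) (norm_nonneg A)
        linarith
      have e5 := le_of_mul_le_mul_right e4 hpos
      nlinarith [norm_nonneg g]
    have hg0 : g = 0 := by
      by_contra hne
      have hp : 0 < ‖g‖ := norm_pos_iff.2 hne
      obtain ⟨n, hn⟩ := exists_nat_gt (2 * ‖A‖ / ‖g‖)
      rw [div_lt_iff₀ hp] at hn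
      exact absurd (bound n) (not_le.2 hn)
    simpa [hg, hb0 k] using hg0
  refine eq_zero_of_forall_eW hβ fun n => ?_
  have hzero : ∀ z ∈ uDisc, wToFun β (A (eW β n)) z = 0 := fun z hz => by
    rw [hA n z hz, hG]
    simp [wToFun]
  have key := coeff_eq_zero_of_hasSum_zero (norm_coeff_div_le hβ (A (eW β n)))
    fun z hz => by
      have := (summable_wToFun hβ (A (eW β n)) hz).hasSum
      rwa [show ∑' m, A (eW β n) m / (β m : ℂ) * z ^ m = 0 from hzero z hz] at this
  ext m
  simpa [hb0 m] using congrFun key m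

/-- An analytic `C₀`-group is norm differentiable at the origin. -/
lemma IsC0Group.differentiableAt_zero {X : Type*} [NormedAddCommGroup X] [NormedSpace ℂ X]
    {T : ℝ → X →L[ℂ] X} (hT : IsC0Group T) (han : IsAnalyticSemigroup T) :
    DifferentiableAt ℝ T 0 := by
  obtain ⟨θ, hθ, Te, hTe, hdiff, -⟩ := han
  have hmem : Sector θ \ {0} ∈ 𝓝 (1 : ℂ) := by
    refine inter_mem ?_ (isOpen_compl_singleton.mem_nhds (by simp))
    have hc : ContinuousAt (fun z : ℂ => |Complex.arg z|) 1 :=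
      (Complex.continuousAt_arg (by simp)).abs
    exact hc.eventually_lt continuousAt_const (by simpa using hθ.1)
  have hd : DifferentiableAt ℝ Te 1 := (hdiff.differentiableAt hmem).restrictScalars ℝ
  have hshift : DifferentiableAt ℝ (fun t : ℝ => ((t + 1 : ℝ) : ℂ)) 0 :=
    Complex.ofRealCLM.differentiableAt.comp 0 (differentiableAt_id.add_const 1)
  have hcomp : DifferentiableAt ℝ (fun t : ℝ => Te ((t + 1 : ℝ) : ℂ)) 0 :=
    DifferentiableAt.comp (g := Te) (0 : ℝ) (by simpa using hd) hshift
  refine (hcomp.mul_const (T (-1))).congr_of_eventuallyEq ?_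
  filter_upwards [Ioi_mem_nhds (show (-1 : ℝ) < 0 by norm_num)] with t ht
  rw [hTe (t + 1) (by linarith [mem_Ioi.1 ht]), ContinuousLinearMap.mul_def, ← hT.2.1]
  congr 1
  ring

/-- A `C₀`-group whose norm derivative at the origin vanishes is trivial. -/
lemma IsC0Group.eq_one_of_hasDerivAt_zero {X : Type*} [NormedAddCommGroup X]
    [NormedSpace ℂ X] {T : ℝ → X →L[ℂ] X} (hT : IsC0Group T) (h : HasDerivAt T 0 0) (t : ℝ) :
    T t = 1 := by
  have hd : ∀ s, HasDerivAt T 0 s := fun s => by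
    have h1 : HasDerivAt (fun r : ℝ => T (r - s)) 0 s :=
      HasDerivAt.comp_sub_const s s (by simpa using h)
    have h2 := h1.mul_const (T s)
    rw [zero_mul] at h2
    refine h2.congr_of_eventuallyEq (Eventually.of_forall fun r => ?_)
    simp only [ContinuousLinearMap.mul_def]
    rw [← hT.2.1, sub_add_cancel]
  rw [is_const_of_deriv_eq_zero (fun s => (hd s).differentiableAt) (fun s => (hd s).deriv) t 0,
    hT.1]

lemma one_le_weight {β : ℕ → ℝ} (hβ : β = hardyW ∨ β = dirichletW) (n : ℕ) : 1 ≤ β n := by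
  rcases hβ with rfl | rfl
  · simp [hardyW]
  · rcases Nat.eq_zero_or_pos n with rfl | hn
    · simp [dirichletW]
    · rw [dirichletW, if_neg hn.ne', Real.one_le_sqrt]
      exact_mod_cast hn

lemma weight_succ_le {β : ℕ → ℝ} (hβ : β = hardyW ∨ β = dirichletW) (k n : ℕ) (hn : 1 ≤ n) :
    β (n + 1) ≤ 2 * β (k + n) := by
  rcases hβ with rfl | rfl
  · norm_num [hardyW]
  · simp only [dirichletW, if_neg (show n + 1 ≠ 0 by omega), if_neg (show k + n ≠ 0 by omega)]
    have h4 : (2 : ℝ) = √4 := by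
      rw [show (4 : ℝ) = 2 ^ 2 by norm_num, Real.sqrt_sq (by norm_num)]
    rw [h4, ← Real.sqrt_mul (by norm_num)]
    refine Real.sqrt_le_sqrt ?_
    have : n + 1 ≤ 4 * (k + n) := by omega
    exact_mod_cast this

/-- The only analytic `C₀`-group of composition operators on
`H²(𝔻)` or `𝒟` is the trivial group. -/
theorem statement8 (β : ℕ → ℝ) (hβ : β = hardyW ∨ β = dirichletW)
    (T : ℝ → WH2 →L[ℂ] WH2) (hT : IsC0Group T)
    (hcomp : ∀ t : ℝ, IsCompositionOperator β (T t))
    (han : IsAnalyticSemigroup T) :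
    ∀ t : ℝ, T t = 1 := by
  have hβ1 := one_le_weight hβ
  have hderiv := (hT.differentiableAt_zero han).hasDerivAt
  set A := deriv T 0
  have hpt : ∀ (f : WH2) (z : ℂ), z ∈ uDisc →
      HasDerivAt (fun t => wToFun β (T t f) z) (wToFun β (A f) z) 0 := fun f z hz =>
    (((evalCLM hβ1 hz).comp (ContinuousLinearMap.apply ℂ WH2 f)).restrictScalars
      ℝ).hasFDerivAt.comp_hasDerivAt 0 hderiv
  have hA : A = 0 := by
    refine eq_zero_of_derivation hβ1 (weight_succ_le hβ) fun n z hz => ?_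
    have h1 := (hpt (eW β 1) z hz).fun_pow n
    refine (hpt (eW β n) z hz).unique ?_
    rw [hT.1, one_apply_eq_self, wToFun_eW hβ1, pow_one] at h1
    refine h1.congr_of_eventuallyEq (Eventually.of_forall fun t => ?_)
    obtain ⟨φ, -, -, hφ⟩ := hcomp t
    simp only [hφ _ z hz, wToFun_eW hβ1, pow_one]
  rw [hA] at hderiv
  exact hT.eq_one_of_hasDerivAt_zero hderiv
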